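/- arXiv:1506.01314 — 3 statements merged into one kernel-verified Lean document; each statement's English description precedes it below -/
import Mathlib

section
/- Let Aut(M) denote the group of all bijections of B preserving the median M (a subgroup of the symmetric group on B). Then: (i) the set T of all translations is a normal subgroup of Aut(M); (ii) the Boolean automorphisms of B form a subgroup of Aut(M); (iii) the only translation that is a Boolean automorphism is the identity; and (iv) every element of Aut(M) equals t_c ∘ ψ for a unique c ∈ B and a unique Boolean automorphism ψ. Hence Aut(M) is the internal semidirect product T ⋊ Aut(B). -/
open scoped symmDiff

/-- `B` is atomless: below every nonzero element there is a strictly smaller nonzero element. -/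
def Atomless (B : Type*) [Preorder B] [OrderBot B] : Prop :=
  ∀ a : B, ⊥ < a → ∃ b : B, ⊥ < b ∧ b < a

/-- A Boolean automorphism: a bijection preserving meet, join and complement. -/
def IsBoolAut {B : Type*} [BooleanAlgebra B] (φ : B → B) : Prop :=
  Function.Bijective φ ∧ (∀ x y, φ (x ⊓ y) = φ x ⊓ φ y) ∧
    (∀ x y, φ (x ⊔ y) = φ x ⊔ φ y) ∧ (∀ x, φ xᶜ = (φ x)ᶜ)

/-- The median function `M(x,y,z) = x·y + y·z + z·x` on a Boolean algebra,
written with symmetric difference as `+` and meet as `·`. -/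
def median {B : Type*} [BooleanAlgebra B] (x y z : B) : B :=
  (x ⊓ y) ∆ ((y ⊓ z) ∆ (z ⊓ x))

section Median

variable {B : Type*} [BooleanAlgebra B]

lemma median_bot (x y : B) : median x y ⊥ = x ⊓ y := by
  simp [median]

lemma median_top (x y : B) : median x y ⊤ = x ⊔ y := by
  rw [median, inf_top_eq, top_inf_eq, symmDiff_comm y x, symmDiff_comm, symmDiff_symmDiff_inf]

lemma median_symmDiff (x y z c : B) :
    median (x ∆ c) (y ∆ c) (z ∆ c) = median x y z ∆ c := by
  simp only [median, inf_symmDiff_distrib_left, inf_symmDiff_distrib_right, inf_idem]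
  rw [inf_comm c y, inf_comm c z, inf_comm c x]
  generalize x ⊓ c = p, y ⊓ c = q, z ⊓ c = r
  simp only [symmDiff_assoc, symmDiff_comm, symmDiff_left_comm, symmDiff_symmDiff_cancel_left]

namespace IsBoolAut

variable {φ : B → B}

lemma map_bot (h : IsBoolAut φ) : φ ⊥ = ⊥ := by
  calc φ ⊥ = φ (⊥ ⊓ ⊥ᶜ) := by rw [inf_compl_self]
    _ = ⊥ := by rw [h.2.1, h.2.2.2, inf_compl_self]

lemma map_symmDiff (h : IsBoolAut φ) (x y : B) : φ (x ∆ y) = φ x ∆ φ y := by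
  simp only [symmDiff_eq, h.2.1, h.2.2.1, h.2.2.2]

lemma map_median (h : IsBoolAut φ) (x y z : B) :
    φ (median x y z) = median (φ x) (φ y) (φ z) := by
  simp only [median, h.map_symmDiff, h.2.1]

end IsBoolAut

/-- A median-preserving bijection that fixes `⊥` is a Boolean automorphism. -/
lemma isBoolAut_of_map_median {ψ : B → B} (hψ : Function.Bijective ψ)
    (hM : ∀ x y z, ψ (median x y z) = median (ψ x) (ψ y) (ψ z)) (h0 : ψ ⊥ = ⊥) :
    IsBoolAut ψ := by
  have hinf : ∀ x y, ψ (x ⊓ y) = ψ x ⊓ ψ y := fun x y => by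
    rw [← median_bot, hM, h0, median_bot]
  have h1 : ψ ⊤ = ⊤ := by
    obtain ⟨a, ha⟩ := hψ.2 ⊤
    have := hinf a ⊤
    rwa [inf_top_eq, ha, top_inf_eq, eq_comm] at this
  have hsup : ∀ x y, ψ (x ⊔ y) = ψ x ⊔ ψ y := fun x y => by
    rw [← median_top, hM, h1, median_top]
  refine ⟨hψ, hinf, hsup, fun x => (IsCompl.compl_eq ?_).symm⟩
  refine IsCompl.of_eq ?_ ?_
  · rw [← hinf, inf_compl_self, h0]
  · rw [← hsup, sup_compl_eq_top, h1]

variable (B) in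
/-- The group of translations `x ↦ x ∆ c`. -/
def translationSubgroup : Subgroup (Equiv.Perm B) where
  carrier := {φ | ∃ c : B, ∀ x, φ x = x ∆ c}
  one_mem' := ⟨⊥, fun x => by simp⟩
  mul_mem' := by
    rintro f g ⟨c, hc⟩ ⟨d, hd⟩
    exact ⟨d ∆ c, fun x => by rw [Equiv.Perm.mul_apply, hc, hd, symmDiff_assoc]⟩
  inv_mem' := by
    rintro f ⟨c, hc⟩
    exact ⟨c, fun x => by rw [Equiv.Perm.inv_eq_iff_eq, hc, symmDiff_symmDiff_cancel_right]⟩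

variable (B) in
/-- The group of median-preserving permutations. -/
def medianAut : Subgroup (Equiv.Perm B) where
  carrier := {φ | ∀ x y z, φ (median x y z) = median (φ x) (φ y) (φ z)}
  one_mem' := fun _ _ _ => rfl
  mul_mem' := fun hf hg x y z => by simp only [Equiv.Perm.mul_apply, hg x y z, hf _ _ _]
  inv_mem' := fun {f} hf x y z => by
    rw [Equiv.Perm.inv_eq_iff_eq, hf]
    simp

lemma isBoolAut_iff_mem_medianAut {φ : Equiv.Perm B} :
    IsBoolAut φ ↔ φ ∈ medianAut B ∧ φ ⊥ = ⊥ :=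
  ⟨fun h => ⟨h.map_median, h.map_bot⟩, fun h => isBoolAut_of_map_median φ.bijective h.1 h.2⟩

variable (B) in
/-- The group of Boolean automorphisms. -/
def boolAutSubgroup : Subgroup (Equiv.Perm B) where
  carrier := {φ | IsBoolAut φ}
  one_mem' := isBoolAut_iff_mem_medianAut.2 ⟨one_mem _, rfl⟩
  mul_mem' := fun {f g} hf hg => by
    have hf' := isBoolAut_iff_mem_medianAut.1 hf
    have hg' := isBoolAut_iff_mem_medianAut.1 hg
    exact isBoolAut_iff_mem_medianAut.2
      ⟨mul_mem hf'.1 hg'.1, by rw [Equiv.Perm.mul_apply, hg'.2, hf'.2]⟩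
  inv_mem' := fun {f} hf => by
    have hf' := isBoolAut_iff_mem_medianAut.1 hf
    exact isBoolAut_iff_mem_medianAut.2
      ⟨inv_mem hf'.1, by rw [Equiv.Perm.inv_eq_iff_eq, hf'.2]⟩

/-- A median-preserving permutation is a Boolean automorphism followed by a translation. -/
lemma exists_isBoolAut_of_mem_medianAut {φ : Equiv.Perm B} (hφ : φ ∈ medianAut B) :
    ∃ ψ : Equiv.Perm B, IsBoolAut ψ ∧ ∀ x, φ x = ψ x ∆ φ ⊥ := by
  have hinv : Function.Involutive (· ∆ φ ⊥) := fun x => symmDiff_symmDiff_cancel_right _ _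
  refine ⟨φ.trans hinv.toPerm, isBoolAut_of_map_median (Equiv.bijective _) (fun x y z => ?_) ?_,
    fun x => (hinv (φ x)).symm⟩
  · change φ (median x y z) ∆ φ ⊥ = median (φ x ∆ φ ⊥) (φ y ∆ φ ⊥) (φ z ∆ φ ⊥)
    rw [median_symmDiff, hφ]
  · exact symmDiff_self _

end Median

/-- `Aut(M) = T ⋊ Aut(B)`: in the symmetric group of the countable atomless Boolean algebra
`B`, the set `T` of translations `x ↦ x + c`, the Boolean automorphisms, and the
median-preserving permutations form subgroups `T'`, `A`, `AutM` such that `T'` and `A` are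
contained in `AutM`, `T'` is normal in `AutM`, `T' ∩ A` is trivial, and every element of
`AutM` is uniquely the composition of a Boolean automorphism followed by a translation:
`Aut(M)` is the internal semidirect product `T ⋊ Aut(B)`. -/
theorem median_aut_eq_semidirect_product
    (B : Type*) [BooleanAlgebra B] [Countable B] [Nontrivial B] (hAtomless : Atomless B) :
    ∃ T' A AutM : Subgroup (Equiv.Perm B),
      ((T' : Set (Equiv.Perm B)) = {φ : Equiv.Perm B | ∃ c : B, ∀ x, φ x = x ∆ c}) ∧
      ((A : Set (Equiv.Perm B)) = {φ : Equiv.Perm B | IsBoolAut ⇑φ}) ∧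
      ((AutM : Set (Equiv.Perm B)) =
        {φ : Equiv.Perm B | ∀ x y z, φ (median x y z) = median (φ x) (φ y) (φ z)}) ∧
      T' ≤ AutM ∧ A ≤ AutM ∧
      (∀ g ∈ AutM, ∀ t ∈ T', g * t * g⁻¹ ∈ T') ∧
      T' ⊓ A = ⊥ ∧
      (∀ φ ∈ AutM, ∃! p : B × Equiv.Perm B,
        p.2 ∈ A ∧ ∀ x, φ x = p.2 x ∆ p.1) := by
  refine ⟨translationSubgroup B, boolAutSubgroup B, medianAut B, rfl, rfl, rfl, ?_,
    fun φ hφ => (isBoolAut_iff_mem_medianAut.1 hφ).1, ?_, ?_, ?_⟩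
  · rintro φ ⟨c, hc⟩ x y z
    simp only [hc, median_symmDiff]
  · rintro g hg t ⟨d, hd⟩
    obtain ⟨ψ, hψ, hgψ⟩ := exists_isBoolAut_of_mem_medianAut hg
    refine ⟨ψ d, fun x => ?_⟩
    rw [Equiv.Perm.mul_apply, Equiv.Perm.mul_apply, hd, hgψ, hψ.map_symmDiff,
      symmDiff_right_comm, ← hgψ, ← Equiv.Perm.mul_apply, mul_inv_cancel,
      Equiv.Perm.one_apply]
  · rw [eq_bot_iff]
    rintro φ ⟨⟨c, hc⟩, hφ⟩
    have hc0 : c = ⊥ := by rw [← bot_symmDiff c, ← hc, IsBoolAut.map_bot hφ]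
    exact Subgroup.mem_bot.2 (Equiv.ext fun x => by
      rw [hc, hc0, symmDiff_bot, Equiv.Perm.one_apply])
  · intro φ hφ
    obtain ⟨ψ, hψ, hφψ⟩ := exists_isBoolAut_of_mem_medianAut hφ
    refine ⟨(φ ⊥, ψ), ⟨hψ, hφψ⟩, ?_⟩
    rintro ⟨c, χ⟩ ⟨hχ, hφχ⟩
    have hc : c = φ ⊥ := by rw [hφχ, IsBoolAut.map_bot hχ, bot_symmDiff]
    refine Prod.ext hc (Equiv.ext fun x => symmDiff_left_injective (φ ⊥) ?_)
    change χ x ∆ φ ⊥ = ψ x ∆ φ ⊥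
    rw [← hφψ, hφχ x, hc]
end

section
/- Let f : Bᵏ → B be a non-linear term function of B. Then every bijection φ : B → B that preserves f also preserves the median M(x, y, z) = x·y + y·z + z·x; equivalently, Aut(B) ≤ Aut(f) ≤ Aut(M), where Aut(f) denotes the group of all bijections of B preserving f. -/
open scoped symmDiff

/-- The term function of arity `k` determined by a set `S` of monomials: the iterated
symmetric difference, over `ε ∈ S`, of the meets `Π_{i ∈ ε} x i` (empty meet is `⊤ = 1`,
empty sum is `⊥ = 0`). -/
def termFun {B : Type*} [BooleanAlgebra B] {k : ℕ} (S : Finset (Finset (Fin k)))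
    (x : Fin k → B) : B :=
  S.fold (· ∆ ·) ⊥ fun ε => ε.inf x

/-- `f` is a non-linear term function: it is given by a set `S` of monomials, one of which
has degree at least `2`. -/
def IsNonLinearTermFun {B : Type*} [BooleanAlgebra B] {k : ℕ} (f : (Fin k → B) → B) : Prop :=
  ∃ S : Finset (Finset (Fin k)), (∀ x, f x = termFun S x) ∧ ∃ ε ∈ S, 2 ≤ ε.card

/-- A bijection `φ` preserves a `k`-ary function `f` if `φ (f x₁ … x_k) = f (φ x₁) … (φ x_k)`. -/
def Preserves {B : Type*} {k : ℕ} (φ : B → B) (f : (Fin k → B) → B) : Prop :=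
  ∀ x : Fin k → B, φ (f x) = f fun i => φ (x i)

namespace BooleanRing

variable {R : Type*} [BooleanRing R]

theorem two_eq_zero : (2 : R) = 0 := by
  rw [← one_add_one_eq_two, add_self]

/-- The median is the join of the pairwise meets. -/
theorem median_eq_join (x y z : R) : x * y + y * z + z * x =
    x * y + y * z + x * y * (y * z) + z * x + (x * y + y * z + x * y * (y * z)) * (z * x) := by
  have h2 := two_eq_zero (R := R)
  have := mul_self x; have := mul_self y; have := mul_self z
  grind

/-- A natural number is `0` or `1` in a Boolean ring. -/
theorem natCast_eq_zero_or_one (n : ℕ) : (n : R) = 0 ∨ (n : R) = 1 := by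
  obtain ⟨m, rfl | rfl⟩ := n.even_or_odd'
  · left; simp [two_eq_zero]
  · right; simp [two_eq_zero]

theorem prod_comp_eq_prod_image {ι κ : Type*} [DecidableEq κ] (σ : ι → κ) (v : κ → R)
    (s : Finset ι) : ∏ i ∈ s, v (σ i) = ∏ j ∈ s.image σ, v j := by
  classical
  induction s using Finset.induction_on with
  | empty => simp
  | insert i s hi ih =>
    rw [Finset.prod_insert hi, ih, Finset.image_insert]
    by_cases h : σ i ∈ s.image σ
    · rw [Finset.insert_eq_of_mem h, ← Finset.mul_prod_erase _ _ h, ← mul_assoc, mul_self]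
    · rw [Finset.prod_insert h]

/-- Identifying the variables of a Boolean polynomial along `σ` collects the monomials
according to their image under `σ`. -/
theorem sum_prod_comp {ι κ : Type*} [Fintype κ] [DecidableEq κ]
    (σ : ι → κ) (v : κ → R) (S : Finset (Finset ι)) :
    ∑ ε ∈ S, ∏ i ∈ ε, v (σ i) =
      ∑ η : Finset κ, ((S.filter fun ε => ε.image σ = η).card : R) * ∏ j ∈ η, v j := by
  simp_rw [prod_comp_eq_prod_image]
  rw [← Finset.sum_fiberwise S (fun ε => ε.image σ)]
  refine Finset.sum_congr rfl fun η _ => ?_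
  rw [Finset.sum_congr rfl (g := fun _ => ∏ j ∈ η, v j)
    (fun ε hε => by rw [(Finset.mem_filter.1 hε).2]), Finset.sum_const, nsmul_eq_mul]

/-- A map preserving a non-linear binary Boolean polynomial preserves meets or joins. -/
theorem map_mul_or_map_sup_of_binary (φ : R → R) {α β γ : R}
    (hα : α = 0 ∨ α = 1) (hβ : β = 0 ∨ β = 1) (hγ : γ = 0 ∨ γ = 1)
    (h : ∀ x y, φ (x * y + α * x + β * y + γ) = φ x * φ y + α * φ x + β * φ y + γ) :
    (∀ x y, φ (x * y) = φ x * φ y) ∨ (∀ x y, φ (x + y + x * y) = φ x + φ y + φ x * φ y) := by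
  have h2 := two_eq_zero (R := R)
  have hR : ∀ x : R, x * x = x := mul_self
  obtain ⟨q, hq⟩ : ∃ q : R → R → R, ∀ x y, q x y = x * y + α * x + β * y + γ := ⟨_, fun _ _ => rfl⟩
  have hφ : ∀ x y, φ (q x y) = q (φ x) (φ y) := by simpa only [hq] using h
  rcases hα with rfl | rfl <;> rcases hβ with rfl | rfl <;> rcases hγ with rfl | rfl
  · left; simpa using h
  · left
    have e : ∀ x y, x * y = q (q x y) (q x y) := fun x y => by
      have := hR x; have := hR y
      rw [hq, hq]; grind
    intro x y; rw [e, hφ, hφ, ← e]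
  · left
    have e : ∀ x y, x * y = q (q x y) y := fun x y => by
      have := hR x; have := hR y
      rw [hq, hq]; grind
    intro x y; rw [e, hφ, hφ, ← e]
  · right
    have e : ∀ x y, x + y + x * y = q x (q x y) := fun x y => by
      have := hR x; have := hR y
      rw [hq, hq]; grind
    intro x y; rw [e, hφ, hφ, ← e]
  · left
    have e : ∀ x y, x * y = q x (q x y) := fun x y => by
      have := hR x; have := hR y
      rw [hq, hq]; grind
    intro x y; rw [e, hφ, hφ, ← e]
  · right
    have e : ∀ x y, x + y + x * y = q (q x y) y := fun x y => by
      have := hR x; have := hR y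
      rw [hq, hq]; grind
    intro x y; rw [e, hφ, hφ, ← e]
  · right
    have e : ∀ x y, x + y + x * y = q x y := fun x y => by
      have := hR x; have := hR y
      rw [hq]; grind
    intro x y; rw [e, hφ, ← e]
  · right
    have e : ∀ x y, x + y + x * y = q (q x y) (q x y) := fun x y => by
      have := hR x; have := hR y
      rw [hq, hq]; grind
    intro x y; rw [e, hφ, hφ, ← e]

/-- A map preserving the sum of the median and an affine polynomial preserves meets, joins or
the median. -/
theorem map_mul_or_map_sup_or_map_median_of_median_add (φ : R → R) {α β γ δ : R}
    (hα : α = 0 ∨ α = 1) (hβ : β = 0 ∨ β = 1) (hγ : γ = 0 ∨ γ = 1) (hδ : δ = 0 ∨ δ = 1)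
    (h : ∀ x y z, φ (x * y + y * z + z * x + α * x + β * y + γ * z + δ) =
      φ x * φ y + φ y * φ z + φ z * φ x + α * φ x + β * φ y + γ * φ z + δ) :
    (∀ x y, φ (x * y) = φ x * φ y) ∨ (∀ x y, φ (x + y + x * y) = φ x + φ y + φ x * φ y) ∨
      ∀ x y z, φ (x * y + y * z + z * x) = φ x * φ y + φ y * φ z + φ z * φ x := by
  have h2 := two_eq_zero (R := R)
  have hR : ∀ x : R, x * x = x := mul_self
  by_cases hsum : α + β + γ = 1
  · -- the diagonal is the constant `δ`
    have hφδ : φ δ = δ := by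
      have := h 0 0 0
      have e : ∀ x : R, x * x + x * x + x * x + α * x + β * x + γ * x + δ = δ := by grind
      rwa [e, e] at this
    have key := map_mul_or_map_sup_of_binary φ (α := α + δ) (β := β + δ) (γ := γ * δ + δ)
      (by grind) (by grind) (by grind) (fun x y => by
        have e : ∀ x y : R, x * y + (α + δ) * x + (β + δ) * y + (γ * δ + δ) =
          x * y + y * δ + δ * x + α * x + β * y + γ * δ + δ := fun x y => by ring
        rw [e, e, h, hφδ])
    exact key.imp_right .inl
  right; right
  have h0 : ∀ x y z, φ (x * y + y * z + z * x + α * x + β * y + γ * z) =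
      φ x * φ y + φ y * φ z + φ z * φ x + α * φ x + β * φ y + γ * φ z := by
    rcases hδ with rfl | rfl
    · simpa using h
    · have hneg : ∀ x, φ (x + 1) = φ x + 1 := by
        intro x
        have e : ∀ x : R, x * x + x * x + x * x + α * x + β * x + γ * x + 1 = x + 1 := by
          grind
        have := h x x x
        rwa [e, e] at this
      intro x y z
      have := h x y z
      rw [hneg] at this
      exact add_right_cancel this
  obtain ⟨p, hp⟩ : ∃ p : R → R → R → R, ∀ x y z,
      p x y z = x * y + y * z + z * x + α * x + β * y + γ * z := ⟨_, fun _ _ _ => rfl⟩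
  have hφ : ∀ x y z, φ (p x y z) = p (φ x) (φ y) (φ z) := by simpa only [hp] using h0
  have cases : (α = 0 ∧ β = 0 ∧ γ = 0) ∨ (α = 1 ∧ β = 1 ∧ γ = 0) ∨ (α = 1 ∧ β = 0 ∧ γ = 1) ∨
      (α = 0 ∧ β = 1 ∧ γ = 1) := by
    rcases hα with rfl | rfl <;> rcases hβ with rfl | rfl <;> rcases hγ with rfl | rfl <;> grind
  rcases cases with ⟨rfl, rfl, rfl⟩ | ⟨rfl, rfl, rfl⟩ | ⟨rfl, rfl, rfl⟩ | ⟨rfl, rfl, rfl⟩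
  · simpa using h0
  · have e : ∀ x y z, x * y + y * z + z * x = p x z (p x z y) := fun x y z => by
      have := hR x; have := hR y; have := hR z
      rw [hp, hp]; grind
    intro x y z; rw [e, hφ, hφ, ← e]
  · have e : ∀ x y z, x * y + y * z + z * x = p x (p x y z) z := fun x y z => by
      have := hR x; have := hR y; have := hR z
      rw [hp, hp]; grind
    intro x y z; rw [e, hφ, hφ, ← e]
  · have e : ∀ x y z, x * y + y * z + z * x = p (p y x z) x z := fun x y z => by
      have := hR x; have := hR y; have := hR z
      rw [hp, hp]; grind
    intro x y z; rw [e, hφ, hφ, ← e]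

/-- A map preserving a ternary Boolean polynomial in which the monomial `x * y` occurs preserves
meets, joins or the median. -/
theorem map_mul_or_map_sup_or_map_median_of_ternary (φ : R → R) {a b c α β γ δ : R}
    (ha : a = 0 ∨ a = 1) (hb : b = 0 ∨ b = 1) (hc : c = 0 ∨ c = 1)
    (hα : α = 0 ∨ α = 1) (hβ : β = 0 ∨ β = 1) (hγ : γ = 0 ∨ γ = 1) (hδ : δ = 0 ∨ δ = 1)
    (h : ∀ x y z, φ (a * (x * y * z) + x * y + b * (y * z) + c * (z * x) +
        α * x + β * y + γ * z + δ) =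
      a * (φ x * φ y * φ z) + φ x * φ y + b * (φ y * φ z) + c * (φ z * φ x) +
        α * φ x + β * φ y + γ * φ z + δ) :
    (∀ x y, φ (x * y) = φ x * φ y) ∨ (∀ x y, φ (x + y + x * y) = φ x + φ y + φ x * φ y) ∨
      ∀ x y z, φ (x * y + y * z + z * x) = φ x * φ y + φ y * φ z + φ z * φ x := by
  have h2 := two_eq_zero (R := R)
  have hR : ∀ x : R, x * x = x := mul_self
  have hadd : ∀ {s t : R}, (s = 0 ∨ s = 1) → (t = 0 ∨ t = 1) → (s + t = 0 ∨ s + t = 1) := by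
    grind
  by_cases hxy : a + b + c = 1
  · have key := map_mul_or_map_sup_of_binary φ (α := 1 + α + β) (β := γ) (γ := δ)
      (hadd (hadd (.inr rfl) hα) hβ) hγ hδ (fun x z => by
        have e : ∀ x z : R, x * z + (1 + α + β) * x + γ * z + δ = a * (x * x * z) + x * x +
          b * (x * z) + c * (z * x) + α * x + β * x + γ * z + δ := fun x z => by
            linear_combination (-(a * z) - 1) * hR x - x * z * hxy
        rw [e, e, h])
    exact key.imp_right .inl
  by_cases hyz : a + 1 + c = 1
  · have key := map_mul_or_map_sup_of_binary φ (α := α) (β := b + β + γ) (γ := δ)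
      hα (hadd (hadd hb hβ) hγ) hδ (fun x y => by
        have e : ∀ x y : R, x * y + α * x + (b + β + γ) * y + δ = a * (x * y * y) + x * y +
          b * (y * y) + c * (y * x) + α * x + β * y + γ * y + δ := fun x y => by
            linear_combination (-(a * x) - b) * hR y - x * y * hyz
        rw [e, e, h])
    exact key.imp_right .inl
  by_cases hzx : a + 1 + b = 1
  · have key := map_mul_or_map_sup_of_binary φ (α := c + α + γ) (β := β) (γ := δ)
      (hadd (hadd hc hα) hγ) hβ hδ (fun x y => by
        have e : ∀ x y : R, x * y + (c + α + γ) * x + β * y + δ = a * (x * y * x) + x * y +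
          b * (y * x) + c * (x * x) + α * x + β * y + γ * x + δ := fun x y => by
            linear_combination (-(a * y) - c) * hR x - x * y * hzx
        rw [e, e, h])
    exact key.imp_right .inl
  obtain ⟨rfl, rfl, rfl⟩ : a = 0 ∧ b = 1 ∧ c = 1 := by
    rcases ha with rfl | rfl <;> rcases hb with rfl | rfl <;> rcases hc with rfl | rfl <;> grind
  exact map_mul_or_map_sup_or_map_median_of_median_add φ hα hβ hγ hδ (by simpa using h)

/-- A map preserving a non-linear Boolean polynomial preserves meets, joins or the median. -/
theorem map_mul_or_map_sup_or_map_median {ι : Type*} [DecidableEq ι] (φ : R → R)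
    (S : Finset (Finset ι)) (hS : ∃ ε ∈ S, 2 ≤ ε.card)
    (h : ∀ x : ι → R, φ (∑ ε ∈ S, ∏ i ∈ ε, x i) = ∑ ε ∈ S, ∏ i ∈ ε, φ (x i)) :
    (∀ x y, φ (x * y) = φ x * φ y) ∨ (∀ x y, φ (x + y + x * y) = φ x + φ y + φ x * φ y) ∨
      ∀ x y z, φ (x * y + y * z + z * x) = φ x * φ y + φ y * φ z + φ z * φ x := by
  obtain ⟨ε, hε, hmin⟩ := (S.filter fun ε => 2 ≤ ε.card).exists_minimal
    (by simpa [Finset.Nonempty] using hS)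
  simp only [Finset.mem_filter] at hε hmin
  obtain ⟨i, hi⟩ : ε.Nonempty := Finset.card_pos.1 (by omega)
  let σ : ι → Fin 3 := fun j => if j = i then 0 else if j ∈ ε then 1 else 2
  let c : Finset (Fin 3) → R := fun η => ((S.filter fun ε' => ε'.image σ = η).card : R)
  have hc : ∀ η, c η = 0 ∨ c η = 1 := fun η => natCast_eq_zero_or_one _
  have hc01 : c {0, 1} = 1 := by
    have : (S.filter fun ε' => ε'.image σ = {0, 1}) = {ε} := by
      ext ε'
      simp only [Finset.mem_filter, Finset.mem_singleton]
      constructor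
      · rintro ⟨hS', him⟩
        have hsub : ε' ⊆ ε := by
          intro j hj
          have : σ j ∈ ({0, 1} : Finset (Fin 3)) := him ▸ Finset.mem_image_of_mem σ hj
          by_contra hjε
          have hji : j ≠ i := fun e => hjε (e ▸ hi)
          simp [σ, hji, hjε] at this
        have hcard : 2 ≤ ε'.card := by
          have := Finset.card_image_le (s := ε') (f := σ)
          rw [him] at this
          simpa using this
        exact hsub.antisymm (hmin ⟨hS', hcard⟩ hsub)
      · rintro rfl
        refine ⟨hε.1, ?_⟩
        obtain ⟨j, hj, hji⟩ := Finset.exists_mem_ne (by omega : 1 < ε'.card) i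
        ext t
        simp only [Finset.mem_image, Finset.mem_insert, Finset.mem_singleton]
        constructor
        · rintro ⟨l, hl, rfl⟩
          by_cases hli : l = i <;> simp [σ, hli, hl]
        · rintro (rfl | rfl)
          · exact ⟨i, hi, by simp [σ]⟩
          · exact ⟨j, hj, by simp [σ, hji, hj]⟩
    simp [c, this]
  have huniv : (Finset.univ : Finset (Finset (Fin 3))) =
      {∅, {0}, {1}, {2}, {0, 1}, {1, 2}, {2, 0}, {0, 1, 2}} := by decide
  have expand : ∀ v : Fin 3 → R, ∑ ε ∈ S, ∏ j ∈ ε, v (σ j) =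
      c {0, 1, 2} * (v 0 * v 1 * v 2) + v 0 * v 1 + c {1, 2} * (v 1 * v 2) +
        c {2, 0} * (v 2 * v 0) + c {0} * v 0 + c {1} * v 1 + c {2} * v 2 + c ∅ := by
    intro v
    rw [sum_prod_comp]
    change ∑ η, c η * _ = _
    rw [huniv]
    repeat rw [Finset.sum_insert (by decide)]
    rw [Finset.sum_singleton, hc01]
    repeat rw [Finset.prod_insert (by decide)]
    simp only [Finset.prod_singleton, Finset.prod_empty]
    ring
  refine map_mul_or_map_sup_or_map_median_of_ternary φ (hc {0, 1, 2}) (hc {1, 2}) (hc {2, 0})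
    (hc {0}) (hc {1}) (hc {2}) (hc ∅) fun x y z => ?_
  have := h fun j => ![x, y, z] (σ j)
  rw [expand ![x, y, z], expand fun t => φ (![x, y, z] t)] at this
  simpa using this

end BooleanRing

section BooleanAlgebra

open scoped BooleanRingOfBooleanAlgebra

variable {B : Type*} [BooleanAlgebra B]

theorem termFun_eq_sum_prod {k : ℕ} (S : Finset (Finset (Fin k))) (x : Fin k → B) :
    termFun S x = ∑ ε ∈ S, ∏ i ∈ ε, x i := by
  have hprod : ∀ ε : Finset (Fin k), ε.inf x = ∏ i ∈ ε, x i := fun _ => rfl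
  simp only [termFun, hprod]
  rfl

theorem median_eq_add (x y z : B) : median x y z = x * y + y * z + z * x :=
  (add_assoc (x * y) (y * z) (z * x)).symm

theorem sup_eq_add_add_mul (x y : B) : x ⊔ y = x + y + x * y :=
  (symmDiff_symmDiff_inf x y).symm

theorem median_eq_sup (x y z : B) : median x y z = (x ⊓ y) ⊔ (y ⊓ z) ⊔ (z ⊓ x) := by
  have hinf : ∀ x y : B, x ⊓ y = x * y := fun _ _ => rfl
  rw [median_eq_add]
  simp only [sup_eq_add_add_mul, hinf]
  exact BooleanRing.median_eq_join x y z

theorem OrderIso.map_median (e : B ≃o B) (x y z : B) :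
    e (median x y z) = median (e x) (e y) (e z) := by
  simp only [median_eq_sup, map_sup, map_inf]

theorem map_median_of_map_inf {φ : B → B} (hφ : Function.Bijective φ)
    (h : ∀ x y, φ (x ⊓ y) = φ x ⊓ φ y) (x y z : B) :
    φ (median x y z) = median (φ x) (φ y) (φ z) :=
  OrderIso.map_median ⟨Equiv.ofBijective φ hφ, fun {a b} => by
    simp [← inf_eq_left, ← h, hφ.1.eq_iff]⟩ x y z

theorem map_median_of_map_sup {φ : B → B} (hφ : Function.Bijective φ)
    (h : ∀ x y, φ (x ⊔ y) = φ x ⊔ φ y) (x y z : B) :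
    φ (median x y z) = median (φ x) (φ y) (φ z) :=
  OrderIso.map_median ⟨Equiv.ofBijective φ hφ, fun {a b} => by
    simp [← sup_eq_right, ← h, hφ.1.eq_iff]⟩ x y z

/-- A bijection preserving a non-linear term function preserves the median. -/
theorem map_median_of_preserves {k : ℕ} {f : (Fin k → B) → B} (hf : IsNonLinearTermFun f)
    {φ : B → B} (hφ : Function.Bijective φ) (hpres : Preserves φ f) (x y z : B) :
    φ (median x y z) = median (φ x) (φ y) (φ z) := by
  obtain ⟨S, hfS, hS⟩ := hf
  simp only [Preserves, hfS, termFun_eq_sum_prod] at hpres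
  obtain h | h | h := BooleanRing.map_mul_or_map_sup_or_map_median φ S hS hpres
  · exact map_median_of_map_inf hφ h x y z
  · exact map_median_of_map_sup hφ (by simpa only [sup_eq_add_add_mul] using h) x y z
  · simpa only [median_eq_add] using h x y z

theorem IsBoolAut.map_bot_s5 {ψ : B → B} (hψ : IsBoolAut ψ) : ψ ⊥ = ⊥ := by
  rw [← inf_compl_self (⊥ : B), hψ.2.1, hψ.2.2.2, inf_compl_self, inf_compl_self]

theorem IsBoolAut.map_top {ψ : B → B} (hψ : IsBoolAut ψ) : ψ ⊤ = ⊤ := by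
  rw [← compl_bot, hψ.2.2.2, hψ.map_bot_s5]

theorem IsBoolAut.map_symmDiff_s5 {ψ : B → B} (hψ : IsBoolAut ψ) (x y : B) :
    ψ (x ∆ y) = ψ x ∆ ψ y := by
  simp only [symmDiff, sdiff_eq, hψ.2.1, hψ.2.2.1, hψ.2.2.2]

theorem IsBoolAut.map_termFun {ψ : B → B} (hψ : IsBoolAut ψ) {k : ℕ}
    (S : Finset (Finset (Fin k))) (x : Fin k → B) :
    ψ (termFun S x) = termFun S fun i => ψ (x i) := by
  have hinf : ∀ ε : Finset (Fin k), ψ (ε.inf x) = ε.inf fun i => ψ (x i) := fun ε =>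
    Finset.apply_inf_eq_inf_comp ψ hψ.2.1 hψ.map_top
  rw [termFun, ← Finset.fold_hom (op' := (· ∆ ·)) hψ.map_symmDiff_s5, hψ.map_bot_s5]
  simp only [hinf, termFun]

end BooleanAlgebra

/-- For every non-linear term function `f` of the countable atomless Boolean algebra `B`:
every Boolean automorphism preserves `f`, and every bijection preserving `f` preserves
the median; that is, `Aut(B) ≤ Aut(f) ≤ Aut(M)`. -/
theorem aut_nonlinear_between_autB_and_autMedian
    (B : Type*) [BooleanAlgebra B] [Countable B] [Nontrivial B] (hAtomless : Atomless B)
    {k : ℕ} (f : (Fin k → B) → B) (hf : IsNonLinearTermFun f) :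
    (∀ ψ : B → B, IsBoolAut ψ → Preserves ψ f) ∧
      (∀ φ : B → B, Function.Bijective φ → Preserves φ f →
        ∀ x y z, φ (median x y z) = median (φ x) (φ y) (φ z)) := by
  refine ⟨fun ψ hψ x => ?_, fun φ hφ hpres x y z => map_median_of_preserves hf hφ hpres x y z⟩
  obtain ⟨S, hfS, -⟩ := hf
  rw [hfS, hfS, hψ.map_termFun]
end

section
/- A bijection φ : B → B preserves the median M(x, y, z) = x·y + y·z + z·x and satisfies φ(0) = 0 if and only if φ is a Boolean automorphism of B; that is, Aut(M) ∩ Aut(0) = Aut(B). -/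
open scoped symmDiff

theorem median_bot_right {B : Type*} [BooleanAlgebra B] (x y : B) : median x y ⊥ = x ⊓ y := by
  simp [median]

theorem median_top_right {B : Type*} [BooleanAlgebra B] (x y : B) : median x y ⊤ = x ⊔ y := by
  rw [median, inf_top_eq, top_inf_eq, symmDiff_comm, symmDiff_comm y x, symmDiff_symmDiff_inf]

theorem IsBoolAut.map_symmDiff_s18 {B : Type*} [BooleanAlgebra B] {φ : B → B} (h : IsBoolAut φ)
    (x y : B) : φ (x ∆ y) = φ x ∆ φ y := by
  obtain ⟨-, hinf, hsup, hcompl⟩ := h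
  simp only [symmDiff_eq, hinf, hsup, hcompl]

theorem IsBoolAut.map_bot_s18 {B : Type*} [BooleanAlgebra B] {φ : B → B} (h : IsBoolAut φ) :
    φ ⊥ = ⊥ := by
  simpa using h.map_symmDiff_s18 ⊥ ⊥

/-- A surjection preserving meets fixes the top element. -/
theorem map_top_of_map_inf_of_surjective {B : Type*} [SemilatticeInf B] [OrderTop B] {φ : B → B}
    (hsurj : Function.Surjective φ) (hinf : ∀ x y, φ (x ⊓ y) = φ x ⊓ φ y) : φ ⊤ = ⊤ := by
  obtain ⟨a, ha⟩ := hsurj ⊤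
  simpa [ha] using (hinf a ⊤).symm

/-- In the countable atomless Boolean algebra `B`, a bijection preserves the median
`M(x,y,z) = x·y + y·z + z·x` and fixes `0 = ⊥` iff it is a Boolean automorphism:
`Aut(M) ∩ Aut(0) = Aut(B)`. -/
theorem preserves_median_and_fixes_bot_iff_boolAut
    (B : Type*) [BooleanAlgebra B] [Countable B] [Nontrivial B] (hAtomless : Atomless B)
    (φ : B → B) (hbij : Function.Bijective φ) :
    ((∀ x y z, φ (median x y z) = median (φ x) (φ y) (φ z)) ∧ φ ⊥ = ⊥) ↔
      IsBoolAut φ := by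
  constructor
  · rintro ⟨hmed, hbot⟩
    have hinf (x y : B) : φ (x ⊓ y) = φ x ⊓ φ y := by
      rw [← median_bot_right, hmed, hbot, median_bot_right]
    have htop : φ ⊤ = ⊤ := map_top_of_map_inf_of_surjective hbij.surjective hinf
    have hsup (x y : B) : φ (x ⊔ y) = φ x ⊔ φ y := by
      rw [← median_top_right, hmed, htop, median_top_right]
    refine ⟨hbij, hinf, hsup, fun x => (IsCompl.compl_eq ?_).symm⟩
    exact IsCompl.of_eq (by rw [← hinf, inf_compl_self, hbot])
      (by rw [← hsup, sup_compl_eq_top, htop])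
  · intro h
    refine ⟨fun x y z => ?_, h.map_bot_s18⟩
    simp only [median, h.map_symmDiff_s18, h.2.1]
end
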